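/- Under the Geometry hypothesis, assume additionally δ > 4δ_0, and let H_𝒢 be the closure in L²(ℱ) of the set of restrictions to ℱ of functions that are harmonic on 𝒢 and square-integrable on 𝒢, with Π the orthogonal projection of L²(ℱ) onto H_𝒢. Then every function h that is harmonic on 𝒦 = ℝ² ∖ closure(𝒪), locally square-integrable on 𝒦, with h(x) → 0 as |x| → ∞, satisfies ‖h‖_{L²(ℱ)} ≤ √(δ/(δ − 4δ_0)) · ‖h|_ℱ − Π(h|_ℱ)‖_{L²(ℱ)}. (Estimate (3.33a) in the proof of Theorem 3.8.) -/

import Mathlib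

open MeasureTheory Metric Filter

noncomputable section

abbrev Pt := EuclideanSpace ℝ (Fin 2)

/-- The Laplacian of `f : ℝ² → ℝ` at `x`, as the sum of the pure second derivatives. -/
def lap (f : Pt → ℝ) (x : Pt) : ℝ :=
  ∑ i : Fin 2, iteratedFDeriv ℝ 2 f x (fun _ => EuclideanSpace.single i (1 : ℝ))

/-- A function is harmonic on an open set `U ⊆ ℝ²` if it is `C²` on `U` and its Laplacian
vanishes on `U`. -/
def IsHarmonicOn (f : Pt → ℝ) (U : Set Pt) : Prop :=
  ContDiffOn ℝ 2 f U ∧ ∀ x ∈ U, lap f x = 0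

/-- Hypothesis 3.1 of the paper (the "Geometry" hypothesis).  The smoothness of the
boundaries plays no role in the estimates and is not recorded. -/
structure Geometry (𝒢 𝒪 : Set Pt) (c : Pt) (Re Ri Rp Rm δ δ₀ : ℝ) : Prop where
  openG : IsOpen 𝒢
  openO : IsOpen 𝒪
  bddG : Bornology.IsBounded 𝒢
  bddO : Bornology.IsBounded 𝒪
  scG : SimplyConnectedSpace 𝒢
  scO : SimplyConnectedSpace 𝒪
  clO_sub_G : closure 𝒪 ⊆ 𝒢
  Rm_pos : 0 < Rm
  Rm_lt_Rp : Rm < Rp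
  Rp_lt_Ri : Rp < Ri
  Ri_lt_Re : Ri < Re
  clG_sub : closure 𝒢 ⊆ ball c Re
  clDi_sub : closedBall c Ri ⊆ 𝒢
  clDp_sub : closedBall c Rp ⊆ ball c Ri
  clDm_sub : closedBall c Rm ⊆ ball c Rp
  clO_sub : closure 𝒪 ⊆ ball c Rm
  Rm_eq : Rm = Re * Real.exp (-δ ^ 2)
  Rp_eq : Rp = Re * Real.exp (-δ)
  δ₀_eq : δ₀ = 2 + Real.log (Re / Ri)
  δ₀_lt_δ : δ₀ < δ

/-- The closure in `L²(ℱ)` of the set of (classes of) restrictions to `ℱ` of functions that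
are harmonic on `𝒢` and square-integrable on `𝒢`. -/
def HGclosure (𝒢 ℱ : Set Pt) : Submodule ℝ (Lp ℝ 2 (volume.restrict ℱ)) :=
  (Submodule.span ℝ {f : Lp ℝ 2 (volume.restrict ℱ) |
      ∃ g : Pt → ℝ, IsHarmonicOn g 𝒢 ∧ IntegrableOn (fun x => g x ^ 2) 𝒢 ∧
        (f : Pt → ℝ) =ᵐ[volume.restrict ℱ] g}).topologicalClosure

instance (𝒢 ℱ : Set Pt) : CompleteSpace (HGclosure 𝒢 ℱ) :=
  (Submodule.isClosed_topologicalClosure _).completeSpace_coe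


def cpart (h : ℂ → ℝ) (z : ℂ) : ℂ := (fderiv ℝ h z 1 : ℂ) - Complex.I * (fderiv ℝ h z Complex.I : ℂ)

lemma fderiv_eq_cpart (h : ℂ → ℝ) (z v : ℂ) : fderiv ℝ h z v = (cpart h z * v).re := by
  have : v = v.re • (1 : ℂ) + v.im • Complex.I := by
    apply Complex.ext <;> simp
  conv_lhs => rw [this, map_add, map_smul, map_smul]
  simp [cpart]
  ring

lemma cpart_eq {h : ℂ → ℝ} {f : ℂ → ℂ} {z f' : ℂ} (hf : HasDerivAt f f' z)
    (he : h =ᶠ[nhds z] fun w => (f w).re) : cpart h z = f' := by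
  have h1 : HasFDerivAt (fun w => (f w).re) _ z :=
    Complex.reCLM.hasFDerivAt.comp z (hf.hasFDerivAt.restrictScalars ℝ)
  have h2 := he.fderiv_eq.trans h1.fderiv
  unfold cpart
  rw [h2]
  apply Complex.ext <;> simp

lemma cpart_bound {h : ℂ → ℝ} {z : ℂ} {R ε : ℝ} (hR : 0 < R) (hε : 0 < ε)
    (hh : InnerProductSpace.HarmonicOnNhd h (ball z R)) (hb : ∀ w ∈ ball z R, |h w| ≤ ε) :
    ‖cpart h z‖ ≤ ε * (2 * Real.exp 2) / R := by
  obtain ⟨f, hf, hfe⟩ := hh.exists_analyticOnNhd_ball_re_eq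
  have hzm : z ∈ ball z R := mem_ball_self hR
  have hd : HasDerivAt f (deriv f z) z := (hf z hzm).differentiableAt.hasDerivAt
  have hc : cpart h z = deriv f z := by
    apply cpart_eq hd
    filter_upwards [isOpen_ball.mem_nhds hzm] with w hw
    exact (hfe hw).symm
  rw [hc]
  set E : ℂ → ℂ := fun w => Complex.exp ((ε⁻¹ : ℝ) * f w) with hE
  have hEd : HasDerivAt E (Complex.exp ((ε⁻¹ : ℝ) * f z) * ((ε⁻¹ : ℝ) * deriv f z)) z :=
    (hd.const_mul _).cexp
  have hn : ∀ w ∈ ball z R, ‖E w‖ = Real.exp (ε⁻¹ * h w) := by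
    intro w hw
    have : (f w).re = h w := hfe hw
    rw [hE, Complex.norm_exp]
    congr 1
    rw [Complex.re_ofReal_mul, this]
  have hsub : closedBall z (R/2) ⊆ ball z R := closedBall_subset_ball (by linarith)
  have hb1 : ∀ w ∈ ball z R, |ε⁻¹ * h w| ≤ 1 := by
    intro w hw
    rw [abs_mul, abs_of_pos (inv_pos.2 hε)]
    calc ε⁻¹ * |h w| ≤ ε⁻¹ * ε := by gcongr; exact hb w hw
      _ = 1 := inv_mul_cancel₀ hε.ne'
  have key : ‖deriv E z‖ ≤ Real.exp 1 / (R/2) := by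
    apply Complex.norm_deriv_le_of_forall_mem_sphere_norm_le (by linarith)
    · have : DifferentiableOn ℂ E (ball z R) := by
        intro w hw
        exact (((hf w hw).differentiableAt.const_mul _).cexp).differentiableWithinAt
      apply DifferentiableOn.diffContOnCl
      rw [closure_ball _ (by linarith)]
      exact this.mono hsub
    · intro w hw
      have hw' := hsub (sphere_subset_closedBall hw)
      rw [hn w hw']
      exact Real.exp_le_exp.2 (abs_le.1 (hb1 w hw')).2
  rw [hEd.deriv, norm_mul, norm_mul] at key
  have h3 : ‖Complex.exp ((ε⁻¹ : ℝ) * f z)‖ = Real.exp (ε⁻¹ * h z) := hn z hzm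
  rw [h3, Complex.norm_real, Real.norm_eq_abs, abs_of_pos (inv_pos.2 hε)] at key
  have h4 : Real.exp (-1) ≤ Real.exp (ε⁻¹ * h z) := Real.exp_le_exp.2 (abs_le.1 (hb1 z hzm)).1
  have h5 : Real.exp (-1) * (ε⁻¹ * ‖deriv f z‖) ≤ Real.exp 1 / (R/2) := le_trans (by gcongr) key
  have h6 : Real.exp 2 = Real.exp 1 * Real.exp 1 := by rw [← Real.exp_add]; norm_num
  have h7 : ‖deriv f z‖ = (Real.exp 1 * ε) * (Real.exp (-1) * (ε⁻¹ * ‖deriv f z‖)) := by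
    rw [Real.exp_neg]; field_simp
  rw [h7]
  calc _ ≤ (Real.exp 1 * ε) * (Real.exp 1 / (R/2)) := by gcongr
    _ = _ := by rw [h6]; field_simp

lemma ext_repr {h : ℂ → ℝ} {ρ : ℝ} (hρ : 0 < ρ)
    (hh : InnerProductSpace.HarmonicOnNhd h (closedBall 0 ρ)ᶜ)
    (hlim : Tendsto h (cocompact ℂ) (nhds 0)) :
    ∃ K : ℂ → ℂ, DifferentiableOn ℂ K (ball 0 ρ⁻¹) ∧ K 0 = 0 ∧
      ∀ w ∈ ball (0:ℂ) ρ⁻¹, w ≠ 0 → h w⁻¹ = (K w).re := by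
  set S : ℂ → ℂ := fun w => - cpart h w⁻¹ / w ^ 2 with hS
  have hρ' : 0 < ρ⁻¹ := inv_pos.2 hρ
  have hmem : ∀ w ∈ ball (0:ℂ) ρ⁻¹, w ≠ 0 → w⁻¹ ∈ (closedBall (0:ℂ) ρ)ᶜ := by
    intro w hw hw0
    simp only [mem_ball_zero_iff, Set.mem_compl_iff, mem_closedBall_zero_iff, not_le, norm_inv] at *
    rw [lt_inv_comm₀ hρ (norm_pos_iff.2 hw0)]
    exact hw
  have hb0 : ball (0:ℂ) ρ⁻¹ ∈ nhds (0:ℂ) := ball_mem_nhds _ hρ'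
  have hSd : DifferentiableOn ℂ S (ball 0 ρ⁻¹ \ {0}) := by
    rintro w ⟨hw, hw0⟩
    have hw0 : w ≠ 0 := hw0
    have h1 : DifferentiableAt ℂ (cpart h) w⁻¹ :=
      HarmonicAt.differentiableAt_complex_partial (hh _ (hmem w hw hw0))
    have h2 : DifferentiableAt ℂ (fun w => cpart h w⁻¹) w := h1.comp w (differentiableAt_inv hw0)
    have h3 : DifferentiableAt ℂ (fun w : ℂ => w ^ 2) w := by fun_prop
    exact (h2.neg.div h3 (pow_ne_zero 2 hw0)).differentiableWithinAt
  have hSo : (fun z => S z - S 0) =o[nhdsWithin 0 {0}ᶜ] fun z => (z - 0)⁻¹ := by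
    have hS0 : S 0 = 0 := by simp [hS]
    simp only [hS0, sub_zero]
    rw [Asymptotics.isLittleO_iff]
    intro η hη
    set ε : ℝ := η / (4 * Real.exp 2) with hε
    have hεp : 0 < ε := by positivity
    have h1 : ∀ᶠ z in cocompact ℂ, |h z| ≤ ε := by
      have := hlim.eventually (closedBall_mem_nhds (0:ℝ) hεp)
      filter_upwards [this] with z hz
      simpa [Real.dist_eq] using hz
    rw [← cobounded_eq_cocompact, (hasBasis_cobounded_norm (E := ℂ)).eventually_iff] at h1
    obtain ⟨M, -, hM⟩ := h1
    set N := max (max M ρ) 1 with hN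
    have hNp : 0 < N := lt_of_lt_of_le one_pos (le_max_right _ _)
    have hB : ball (0:ℂ) ((2 * N)⁻¹) ∈ nhds (0:ℂ) := ball_mem_nhds _ (by positivity)
    filter_upwards [nhdsWithin_le_nhds hB, self_mem_nhdsWithin] with w hw hw0
    have hw0 : w ≠ 0 := hw0
    have hwp := norm_pos_iff.2 hw0
    have hwn : 2 * N < ‖w⁻¹‖ := by
      rw [norm_inv, lt_inv_comm₀ (by positivity) hwp]; simpa using hw
    have hfar : ∀ u ∈ ball w⁻¹ (‖w⁻¹‖/2), N < ‖u‖ := by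
      intro u hu
      rw [mem_ball, dist_eq_norm] at hu
      have := norm_sub_norm_le w⁻¹ u
      rw [norm_sub_rev] at this
      linarith
    have hP := cpart_bound (h := h) (z := w⁻¹) (R := ‖w⁻¹‖/2) (ε := ε) (by linarith) hεp
      (fun u hu => hh u (by
        have := hfar u hu
        simp only [Set.mem_compl_iff, mem_closedBall_zero_iff, not_le]
        exact lt_of_le_of_lt (le_trans (le_max_right _ _) (le_max_left _ _)) this))
      (fun u hu => hM (le_of_lt (lt_of_le_of_lt (le_trans (le_max_left _ _) (le_max_left _ _)) (hfar u hu))))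
    simp only [hS, norm_div, norm_neg, norm_pow, norm_inv] at hP ⊢
    rw [div_le_iff₀ (by positivity)]
    refine hP.trans (le_of_eq ?_)
    rw [hε]; field_simp; ring
  have hT := Complex.differentiableOn_update_limUnder_of_isLittleO hb0 hSd hSo
  set T := Function.update S 0 (limUnder (nhdsWithin 0 {0}ᶜ) S) with hTdef
  obtain ⟨K, hK0, hK⟩ := hT.isExactOn_ball.with_val_at 0 0
  have hKd : DifferentiableOn ℂ K (ball 0 ρ⁻¹) := fun w hw => (hK w hw).differentiableAt.differentiableWithinAt
  refine ⟨K, hKd, hK0, ?_⟩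
  set D : ℂ → ℝ := fun w => h w⁻¹ - (K w).re with hD
  set U : Set ℂ := ball 0 ρ⁻¹ \ {0} with hU
  have hUo : IsOpen U := isOpen_ball.sdiff isClosed_singleton
  have hUc : IsPreconnected U := by
    have h1 : IsPreconnected ((fun p : ℝ × ℝ => circleMap 0 p.1 p.2) '' (Set.Ioo 0 ρ⁻¹ ×ˢ Set.univ)) := by
      apply IsPreconnected.image
      · exact isPreconnected_Ioo.prod isPreconnected_univ
      · unfold circleMap; fun_prop
    convert h1
    ext w
    simp only [hU, Set.mem_sdiff, mem_ball_zero_iff, Set.mem_singleton_iff, Set.mem_image, Set.mem_prod,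
      Set.mem_Ioo, Set.mem_univ, and_true, Prod.exists]
    constructor
    · rintro ⟨h1, h2⟩
      refine ⟨‖w‖, w.arg, ⟨norm_pos_iff.2 h2, h1⟩, ?_⟩
      simp [circleMap]
    · rintro ⟨r, t, ⟨h1, h2⟩, rfl⟩
      have h3 : ‖circleMap 0 r t‖ = r := by rw [norm_circleMap_zero, abs_of_pos h1]
      refine ⟨h3.le.trans_lt h2, fun h4 => ?_⟩
      rw [h4, norm_zero] at h3
      linarith
  have hDd : ∀ w ∈ U, HasFDerivAt D (0 : ℂ →L[ℝ] ℝ) w := by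
    rintro w ⟨hw, hw0⟩
    have hw0 : w ≠ 0 := hw0
    have h1 : DifferentiableAt ℝ h w⁻¹ := (hh _ (hmem w hw hw0)).1.differentiableAt two_ne_zero
    have h2 : HasFDerivAt (fun w : ℂ => w⁻¹) _ w := (hasDerivAt_inv hw0).hasFDerivAt.restrictScalars ℝ
    have h3 := h1.hasFDerivAt.comp w h2
    have h4 : HasFDerivAt (fun w => (K w).re) _ w :=
      Complex.reCLM.hasFDerivAt.comp w ((hK w hw).hasFDerivAt.restrictScalars ℝ)
    refine (h3.sub h4).congr_fderiv ?_
    ext v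
    have hTw : T w = S w := by rw [hTdef, Function.update_of_ne hw0]
    simp only [sub_apply, ContinuousLinearMap.comp_apply, zero_apply,
      fderiv_eq_cpart, hTw, hS]
    simp only [ContinuousLinearMap.coe_restrictScalars', ContinuousLinearMap.toSpanSingleton_apply,
      smul_eq_mul, Complex.reCLM_apply]
    rw [← Complex.sub_re]
    convert Complex.zero_re using 2
    field_simp
    ring
  have hlimD : Tendsto D (nhdsWithin 0 {0}ᶜ) (nhds 0) := by
    have h1 : Tendsto (fun w : ℂ => h w⁻¹) (nhdsWithin 0 {0}ᶜ) (nhds 0) := by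
      apply hlim.comp
      rw [← cobounded_eq_cocompact]
      exact tendsto_inv₀_nhdsNE_zero
    have h2 : Tendsto (fun w => (K w).re) (nhdsWithin 0 {0}ᶜ) (nhds 0) := by
      have : ContinuousAt K 0 := (hKd.differentiableAt hb0).continuousAt
      have h3 := Complex.continuous_re.continuousAt.comp this
      have h4 := h3.tendsto.mono_left (nhdsWithin_le_nhds (s := {0}ᶜ))
      simpa [hK0, Function.comp_def] using h4
    simpa using h1.sub h2
  intro w hw hw0
  have hconst : ∀ u ∈ U, D u = D w := by
    intro u hu
    exact hUo.is_const_of_fderiv_eq_zero hUc (fun x hx => (hDd x hx).differentiableAt.differentiableWithinAt)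
      (fun x hx => (hDd x hx).fderiv) hu ⟨hw, hw0⟩
  have hlim2 : Tendsto D (nhdsWithin 0 {0}ᶜ) (nhds (D w)) := by
    apply tendsto_const_nhds.congr'
    filter_upwards [nhdsWithin_le_nhds hb0, self_mem_nhdsWithin] with u hu hu0
    exact (hconst u ⟨hu, hu0⟩).symm
  have := tendsto_nhds_unique hlim2 hlimD
  simp only [hD] at this
  linarith

open Real in
lemma G_diff {F : ℂ → ℂ} {R : ℝ} (hF : DifferentiableOn ℂ F (ball 0 R)) {w : ℝ → ℂ} (hw : Continuous w) :
    DifferentiableOn ℂ (fun z => ∫ θ in (0:ℝ)..2*π, F (z * circleMap 0 1 θ) * w θ) (ball 0 R) := by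
  intro z₀ hz₀
  apply DifferentiableAt.differentiableWithinAt
  rw [mem_ball_zero_iff] at hz₀
  obtain ⟨s, hs1, hs2⟩ := exists_between hz₀
  have hsub : closedBall (0:ℂ) s ⊆ ball 0 R := closedBall_subset_ball hs2
  have hdF : DifferentiableOn ℂ (deriv F) (ball 0 R) := hF.deriv isOpen_ball
  obtain ⟨C, hC⟩ := (isCompact_closedBall (0:ℂ) s).exists_bound_of_continuousOn (hdF.continuousOn.mono hsub)
  have he : ∀ θ, ‖circleMap 0 1 θ‖ = 1 := by intro θ; simp
  have hmemc : ∀ z ∈ ball (0:ℂ) s, ∀ θ, z * circleMap 0 1 θ ∈ closedBall (0:ℂ) s := by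
    intro z hz θ
    rw [mem_closedBall_zero_iff, norm_mul, he, mul_one]
    exact (mem_ball_zero_iff.1 hz).le
  have hcont : ∀ f : ℂ → ℂ, ContinuousOn f (ball 0 R) → ∀ z ∈ ball (0:ℂ) s,
      Continuous fun θ => f (z * circleMap 0 1 θ) := by
    intro f hf z hz
    apply hf.comp_continuous (by fun_prop)
    intro θ
    exact hsub (hmemc z hz θ)
  have hz0s : z₀ ∈ ball (0:ℂ) s := by simpa using hs1
  have key := intervalIntegral.hasDerivAt_integral_of_dominated_loc_of_deriv_le (𝕜 := ℂ) (μ := volume)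
    (a := 0) (b := 2*π) (s := ball 0 s) (x₀ := z₀)
    (F := fun z θ => F (z * circleMap 0 1 θ) * w θ)
    (F' := fun z θ => (deriv F (z * circleMap 0 1 θ) * circleMap 0 1 θ) * w θ)
    (bound := fun θ => C * ‖w θ‖)
    (isOpen_ball.mem_nhds hz0s) ?_ ?_ ?_ ?_ ?_ ?_
  · exact key.2.differentiableAt
  · filter_upwards [isOpen_ball.mem_nhds hz0s] with z hz
    exact ((hcont F hF.continuousOn z hz).mul hw).aestronglyMeasurable
  · exact ((hcont F hF.continuousOn _ hz0s).mul hw).intervalIntegrable _ _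
  · have := hcont (deriv F) hdF.continuousOn _ hz0s
    exact Continuous.aestronglyMeasurable (by fun_prop)
  · refine Eventually.of_forall fun θ _ z hz => ?_
    rw [norm_mul, norm_mul, he, mul_one]
    gcongr
    exact hC _ (hmemc z hz θ)
  · exact Continuous.intervalIntegrable (by fun_prop) _ _
  · refine Eventually.of_forall fun θ _ z hz => ?_
    apply HasDerivAt.mul_const
    have h1 : HasDerivAt F (deriv F (z * circleMap 0 1 θ)) (z * circleMap 0 1 θ) :=
      (hF.differentiableAt (isOpen_ball.mem_nhds (hsub (hmemc z hz θ)))).hasDerivAt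
    have h2 : HasDerivAt (fun z : ℂ => z * circleMap 0 1 θ) (1 * circleMap 0 1 θ) z :=
      (hasDerivAt_id z).mul_const _
    rw [one_mul] at h2
    exact h1.comp z h2

open Real in
lemma mean_mono {F : ℂ → ℂ} {R r s : ℝ} (hF : DifferentiableOn ℂ F (ball 0 R)) (hr : 0 ≤ r)
    (hrs : r ≤ s) (hsR : s < R) :
    circleAverage (fun z => ‖F z‖ ^ 2) 0 r ≤ circleAverage (fun z => ‖F z‖ ^ 2) 0 s := by
  rcases eq_or_lt_of_le hrs with rfl | hlt
  · exact le_rfl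
  have hs : 0 < s := hr.trans_lt hlt
  have hcm : ∀ t θ, circleMap 0 t θ = (t:ℂ) * circleMap 0 1 θ := by intro t θ; simp [circleMap]
  have he : ∀ θ, ‖circleMap 0 1 θ‖ = 1 := by intro θ; simp
  have hc : ∀ z : ℂ, ‖z‖ < R → Continuous fun θ => F (z * circleMap 0 1 θ) := by
    intro z hz
    apply hF.continuousOn.comp_continuous (by fun_prop)
    intro θ
    rw [mem_ball_zero_iff, norm_mul, he, mul_one]; exact hz
  have hnr : ‖(r:ℂ)‖ < R := by rw [Complex.norm_real, Real.norm_of_nonneg hr]; linarith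
  have hw : Continuous fun θ => (starRingEnd ℂ) (F (r * circleMap 0 1 θ)) :=
    Complex.continuous_conj.comp (hc r hnr)
  set G : ℂ → ℂ := fun z => ∫ θ in (0:ℝ)..2*π, F (z * circleMap 0 1 θ) * (starRingEnd ℂ) (F (r * circleMap 0 1 θ)) with hG
  have hGd := G_diff hF hw
  set M : ℝ → ℝ := fun t => ∫ θ in (0:ℝ)..2*π, ‖F (t * circleMap 0 1 θ)‖^2 with hM
  have hav : ∀ t, circleAverage (fun z => ‖F z‖ ^ 2) 0 t = (2*π)⁻¹ * M t := by
    intro t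
    rw [circleAverage_def, hM, smul_eq_mul]
    simp only [hcm t]
  rw [hav, hav]
  have hGr : ‖G r‖ = M r := by
    have : G r = ((M r : ℝ) : ℂ) := by
      rw [hG, hM]
      simp only
      rw [← intervalIntegral.integral_ofReal]
      congr 1; ext θ
      rw [Complex.mul_conj, Complex.normSq_eq_norm_sq]
    rw [this, Complex.norm_real, Real.norm_of_nonneg]
    rw [hM]
    exact intervalIntegral.integral_nonneg (by positivity) (fun θ _ => by positivity)
  have hbd : ‖G r‖ ≤ (M s + M r) / 2 := by
    apply Complex.norm_le_of_forall_mem_frontier_norm_le (isBounded_ball (x := (0:ℂ)) (r := s))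
    · apply DifferentiableOn.diffContOnCl
      rw [closure_ball _ hs.ne']
      exact hGd.mono (closedBall_subset_ball hsR)
    · intro z hz
      rw [frontier_ball _ hs.ne', mem_sphere_zero_iff_norm] at hz
      have hzR : ‖z‖ < R := by linarith
      have hMz : M s = ∫ θ in (0:ℝ)..2*π, ‖F (z * circleMap 0 1 θ)‖^2 := by
        have h1 := hav s
        rw [circleAverage_eq_integral_add z.arg, smul_eq_mul] at h1
        have h2 : (2*π)⁻¹ ≠ 0 := by positivity
        rw [← mul_left_cancel₀ h2 h1]
        congr 1; ext θ
        congr 3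
        have : z = s * Complex.exp (z.arg * Complex.I) := by
          rw [← hz]; simp
        conv_rhs => rw [this]
        simp only [circleMap, zero_add, Complex.ofReal_add, add_mul, Complex.exp_add, Complex.ofReal_one, one_mul]
        ring
      rw [hMz, hM, ← intervalIntegral.integral_add, ← intervalIntegral.integral_div]
      · apply intervalIntegral.norm_integral_le_of_norm_le (by positivity)
        · refine Eventually.of_forall fun θ _ => ?_
          rw [norm_mul, RCLike.norm_conj]
          nlinarith [sq_nonneg (‖F (z * circleMap 0 1 θ)‖ - ‖F (r * circleMap 0 1 θ)‖)]
        · exact ((((hc z hzR).norm.pow 2).add ((hc r hnr).norm.pow 2)).div_const 2).intervalIntegrable _ _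
      · exact ((hc z hzR).norm.pow 2).intervalIntegrable _ _
      · exact ((hc r hnr).norm.pow 2).intervalIntegrable _ _
    · rw [closure_ball _ hs.ne', mem_closedBall_zero_iff, Complex.norm_real, Real.norm_of_nonneg hr]
      exact hrs
  rw [hGr] at hbd
  have : M r ≤ M s := by linarith
  gcongr

open Real in
lemma mean_re_sq {K : ℂ → ℂ} {R r : ℝ} (hK : DifferentiableOn ℂ K (ball 0 R)) (hr : 0 ≤ r) (hrR : r < R) :
    circleAverage (fun z => (K z).re ^ 2) 0 r =
      2⁻¹ * circleAverage (fun z => ‖K z‖ ^ 2) 0 r + 2⁻¹ * (K 0 ^ 2).re := by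
  have hsub : closedBall (0:ℂ) |r| ⊆ ball 0 R := closedBall_subset_ball (by rwa [abs_of_nonneg hr])
  have hcs : ContinuousOn K (sphere 0 |r|) := (hK.continuousOn.mono hsub).mono sphere_subset_closedBall
  have h1 : circleAverage (fun z => K z ^ 2) 0 r = K 0 ^ 2 := by
    have : DiffContOnCl ℂ (fun z => K z ^ 2) (ball 0 |r|) := by
      apply DifferentiableOn.diffContOnCl
      exact (hK.mono (closure_ball_subset_closedBall.trans hsub)).pow 2
    exact this.circleAverage
  have i1 : CircleIntegrable (fun z => K z ^ 2) 0 r := (hcs.pow 2).circleIntegrable'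
  have h2 : circleAverage (fun z => (K z ^ 2).re) 0 r = (K 0 ^ 2).re := by
    rw [← h1]
    exact Complex.reCLM.circleAverage_comp_comm i1
  have i2 : CircleIntegrable (fun z => (K z ^ 2).re) 0 r :=
    (Complex.continuous_re.comp_continuousOn (hcs.pow 2)).circleIntegrable'
  have i3 : CircleIntegrable (fun z => ‖K z‖ ^ 2) 0 r := (hcs.norm.pow 2).circleIntegrable'
  rw [← h2, ← smul_eq_mul, ← smul_eq_mul, ← circleAverage_fun_smul, ← circleAverage_fun_smul,
    ← circleAverage_fun_add]
  · congr 1; ext z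
    rw [← Complex.normSq_eq_norm_sq, Complex.normSq_apply]
    simp [pow_two]; ring
  · exact i3.const_fun_smul
  · exact i2.const_fun_smul

open Real in
lemma lintegral_annulus {u : ℂ → ℝ} {a b : ℝ} (ha : 0 ≤ a) (hu0 : ∀ z, 0 ≤ u z)
    (hu : ContinuousOn u {z | a < ‖z‖ ∧ ‖z‖ < b}) :
    ∫⁻ z in {z : ℂ | a < ‖z‖ ∧ ‖z‖ < b}, ENNReal.ofReal (u z) =
      ∫⁻ r in Set.Ioo a b, ENNReal.ofReal (2 * π * r * circleAverage u 0 r) := by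
  set A : Set ℂ := {z : ℂ | a < ‖z‖ ∧ ‖z‖ < b} with hA
  have hAo : IsOpen A := (isOpen_lt continuous_const continuous_norm).inter (isOpen_lt continuous_norm continuous_const)
  classical
  set f : ℂ → ENNReal := A.indicator (fun z => ENNReal.ofReal (u z)) with hf
  have hfm : Measurable f := by
    have h1 : Measurable (A.piecewise u (fun _ => 0)) :=
      hu.measurable_piecewise continuousOn_const hAo.measurableSet
    convert h1.ennreal_ofReal using 1
    ext z
    by_cases hz : z ∈ A <;> simp [hf, hz]
  rw [← lintegral_indicator hAo.measurableSet, ← Complex.lintegral_comp_polarCoord_symm]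
  have hcm : ∀ p : ℝ × ℝ, Complex.polarCoord.symm p = circleMap 0 p.1 p.2 := by
    intro p
    rw [Complex.polarCoord_symm_apply]
    simp [circleMap, Complex.exp_mul_I]
  simp only [hcm, ← hf, smul_eq_mul]
  rw [show polarCoord.target = Set.Ioi (0:ℝ) ×ˢ Set.Ioo (-π) π from rfl, Measure.volume_eq_prod,
    ← Measure.prod_restrict, lintegral_prod]
  swap
  · apply Measurable.aemeasurable
    apply Measurable.mul (by fun_prop)
    apply hfm.comp
    apply Continuous.measurable
    unfold circleMap; fun_prop
  rw [← lintegral_indicator measurableSet_Ioi, ← lintegral_indicator measurableSet_Ioo]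
  congr 1; ext r
  by_cases hr : r ∈ Set.Ioo a b
  · have hr0 : 0 < r := ha.trans_lt hr.1
    rw [Set.indicator_of_mem (show r ∈ Set.Ioi (0:ℝ) from hr0), Set.indicator_of_mem hr]
    have hm : ∀ θ, circleMap 0 r θ ∈ A := by
      intro θ
      simp only [hA, Set.mem_ofPred_eq, norm_circleMap_zero, abs_of_pos hr0]
      exact hr
    have hcont : Continuous fun θ => u (circleMap 0 r θ) := hu.comp_continuous (by fun_prop) hm
    simp only [hf, Set.indicator_of_mem (hm _)]
    rw [lintegral_const_mul _ hcont.measurable.ennreal_ofReal, ← ofReal_integral_eq_lintegral_ofReal,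
      ← ENNReal.ofReal_mul hr0.le]
    · congr 1
      rw [circleAverage_eq_integral_add (-π), smul_eq_mul,
        intervalIntegral.integral_comp_add_right (fun θ => u (circleMap 0 r θ)),
        intervalIntegral.integral_of_le (by linarith [pi_pos]), integral_Ioc_eq_integral_Ioo]
      rw [show 0 + -π = -π by ring, show 2 * π + -π = π by ring]
      have := pi_pos
      field_simp
    · exact (hcont.integrableOn_Icc (a := -π) (b := π)).mono_set Set.Ioo_subset_Icc_self
    · exact Eventually.of_forall fun _ => hu0 _
  · rw [Set.indicator_of_notMem hr]
    by_cases hr0 : r ∈ Set.Ioi (0:ℝ)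
    · rw [Set.indicator_of_mem hr0]
      have hm : ∀ θ, circleMap 0 r θ ∉ A := by
        intro θ
        simp only [hA, Set.mem_ofPred_eq, norm_circleMap_zero, abs_of_pos (show 0 < r from hr0)]
        exact hr
      simp [hf, Set.indicator_of_notMem (hm _)]
    · rw [Set.indicator_of_notMem hr0]

open Real in
lemma ext_mean_mono {h : ℂ → ℝ} {ρ r s : ℝ} (hρ : 0 < ρ)
    (hh : InnerProductSpace.HarmonicOnNhd h (closedBall 0 ρ)ᶜ)
    (hlim : Tendsto h (cocompact ℂ) (nhds 0)) (hr : ρ < r) (hrs : r ≤ s) :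
    s ^ 2 * circleAverage (fun z => h z ^ 2) 0 s ≤ r ^ 2 * circleAverage (fun z => h z ^ 2) 0 r := by
  obtain ⟨K, hK, hK0, hKh⟩ := ext_repr hρ hh hlim
  have hb0 : ball (0:ℂ) ρ⁻¹ ∈ nhds (0:ℂ) := ball_mem_nhds _ (inv_pos.2 hρ)
  set F := dslope K 0 with hF
  have hFd : DifferentiableOn ℂ F (ball 0 ρ⁻¹) := (Complex.differentiableOn_dslope hb0).2 hK
  have hKF : ∀ w, K w = w * F w := by
    intro w
    have := sub_smul_dslope K 0 w
    simpa [hK0] using this.symm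
  have key : ∀ t, ρ < t → t ^ 2 * circleAverage (fun z => h z ^ 2) 0 t =
      2⁻¹ * circleAverage (fun z => ‖F z‖ ^ 2) 0 t⁻¹ := by
    intro t ht
    have ht0 : 0 < t := hρ.trans ht
    have hti : t⁻¹ < ρ⁻¹ := inv_strictAnti₀ hρ ht
    have e1 : circleAverage (fun z => h z ^ 2) 0 t = circleAverage (fun z => (K z).re ^ 2) 0 t⁻¹ := by
      rw [circleAverage_eq_circleAverage_zero_one, ← circleAverage_zero_one_congr_inv,
        circleAverage_eq_circleAverage_zero_one (R := t⁻¹)]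
      apply circleAverage_congr_sphere
      intro z hz
      have hz1 : ‖z‖ = 1 := by simpa using hz
      have hz0 : z ≠ 0 := by rintro rfl; simp at hz1
      have := hKh ((t⁻¹ : ℝ) * z) (by
        rw [mem_ball_zero_iff, norm_mul, hz1, mul_one, Complex.norm_real,
          Real.norm_of_nonneg (inv_pos.2 ht0).le]
        exact hti) (mul_ne_zero (by exact_mod_cast (inv_pos.2 ht0).ne') hz0)
      simp only [add_zero]
      rw [← this]
      push_cast
      rw [mul_inv, inv_inv]
    have e2 : circleAverage (fun z => ‖K z‖ ^ 2) 0 t⁻¹ = (t⁻¹)^2 * circleAverage (fun z => ‖F z‖ ^ 2) 0 t⁻¹ := by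
      rw [← smul_eq_mul, ← circleAverage_fun_smul]
      apply circleAverage_congr_sphere
      intro z hz
      have hz1 : ‖z‖ = t⁻¹ := by
        simpa [abs_of_pos ht0] using hz
      simp only [hKF, norm_mul, hz1, smul_eq_mul]
      ring
    rw [e1, mean_re_sq hK (inv_pos.2 ht0).le hti, e2, hK0]
    simp
    field_simp
  rw [key s (hr.trans_le hrs), key r hr]
  have hr0 := hρ.trans hr
  have := mean_mono hFd (r := s⁻¹) (s := r⁻¹) (inv_pos.2 (hr0.trans_le hrs)).le
    (inv_anti₀ hr0 hrs) (inv_strictAnti₀ hρ hr)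
  linarith

open Real in
lemma int_mean_mono {g : ℂ → ℝ} {R r s : ℝ} 
    (hg : InnerProductSpace.HarmonicOnNhd g (ball 0 R)) (hr : 0 ≤ r) (hrs : r ≤ s) (hsR : s < R) :
    circleAverage (fun z => g z ^ 2) 0 r ≤ circleAverage (fun z => g z ^ 2) 0 s := by
  obtain ⟨f, hf, hfe⟩ := hg.exists_analyticOnNhd_ball_re_eq
  have hfd : DifferentiableOn ℂ f (ball 0 R) := hf.differentiableOn
  have key : ∀ t, 0 ≤ t → t < R → circleAverage (fun z => g z ^ 2) 0 t =
      2⁻¹ * circleAverage (fun z => ‖f z‖ ^ 2) 0 t + 2⁻¹ * (f 0 ^ 2).re := by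
    intro t ht htR
    rw [← mean_re_sq hfd ht htR]
    apply circleAverage_congr_sphere
    intro z hz
    have hz1 : ‖z‖ = t := by simpa [abs_of_nonneg ht] using hz
    have := hfe (show z ∈ ball (0:ℂ) R by rw [mem_ball_zero_iff, hz1]; exact htR)
    simp only at this ⊢
    rw [this]
  rw [key r hr (hrs.trans_lt hsR), key s (hr.trans hrs) hsR]
  have := mean_mono hfd hr hrs hsR
  linarith

lemma lint_inv {a b C : ℝ} (ha : 0 < a) (hab : a ≤ b) (hC : 0 ≤ C) :
    ∫⁻ r in Set.Ioo a b, ENNReal.ofReal (C * r⁻¹) = ENNReal.ofReal (C * Real.log (b / a)) := by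
  rw [← ofReal_integral_eq_lintegral_ofReal]
  · rw [← integral_Ioc_eq_integral_Ioo, ← intervalIntegral.integral_of_le hab,
      intervalIntegral.integral_const_mul, integral_inv_of_pos ha (ha.trans_le hab)]
  · have : ContinuousOn (fun r : ℝ => C * r⁻¹) (Set.Icc a b) := by
      apply continuousOn_const.mul
      exact continuousOn_inv₀.mono (fun r hr => (ha.trans_le hr.1).ne')
    exact (this.integrableOn_Icc).mono_set Set.Ioo_subset_Icc_self
  · filter_upwards [ae_restrict_mem measurableSet_Ioo] with r hr
    have : 0 < r := ha.trans hr.1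
    positivity

lemma lint_id {a b C : ℝ} (ha : 0 ≤ a) (hab : a ≤ b) (hC : 0 ≤ C) :
    ∫⁻ r in Set.Ioo a b, ENNReal.ofReal (C * r) = ENNReal.ofReal (C * ((b ^ 2 - a ^ 2) / 2)) := by
  rw [← ofReal_integral_eq_lintegral_ofReal]
  · rw [← integral_Ioc_eq_integral_Ioo, ← intervalIntegral.integral_of_le hab,
      intervalIntegral.integral_const_mul, integral_id]
  · exact (Continuous.integrableOn_Icc (by fun_prop)).mono_set Set.Ioo_subset_Icc_self
  · filter_upwards [ae_restrict_mem measurableSet_Ioo] with r hr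
    have : 0 ≤ r := ha.trans hr.1.le
    positivity

open Real in
lemma ext_bound {h : ℂ → ℝ} {ρ b d : ℝ} (hρ : 0 < ρ) (hρb : ρ < b) (hbd : b ≤ d)
    (hh : InnerProductSpace.HarmonicOnNhd h (closedBall 0 ρ)ᶜ)
    (hlim : Tendsto h (cocompact ℂ) (nhds 0)) :
    ENNReal.ofReal (log (b / ρ)) * ∫⁻ z in {z : ℂ | b < ‖z‖ ∧ ‖z‖ < d}, ENNReal.ofReal (h z ^ 2) ≤
      ENNReal.ofReal (log (d / b)) * ∫⁻ z in {z : ℂ | ρ < ‖z‖ ∧ ‖z‖ < b}, ENNReal.ofReal (h z ^ 2) := by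
  have hb : 0 < b := hρ.trans hρb
  have hc : ContinuousOn (fun z => h z ^ 2) (closedBall 0 ρ)ᶜ := hh.contDiffOn.continuousOn.pow 2
  have hm : ∀ z : ℂ, ρ < ‖z‖ → z ∈ (closedBall (0:ℂ) ρ)ᶜ := by
    intro z hz; simpa using hz
  rw [lintegral_annulus hb.le (fun z => sq_nonneg _) (hc.mono fun z hz => hm z (hρb.trans hz.1)),
    lintegral_annulus hρ.le (fun z => sq_nonneg _) (hc.mono fun z hz => hm z hz.1)]
  set φ : ℝ → ℝ := fun r => circleAverage (fun z => h z ^ 2) 0 r with hφ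
  have hmono : ∀ r s, ρ < r → r ≤ s → s ^ 2 * φ s ≤ r ^ 2 * φ r := fun r s hr hrs =>
    ext_mean_mono hρ hh hlim hr hrs
  set C := 2 * π * (b ^ 2 * φ b) with hC
  have hCn : 0 ≤ C := by
    have : 0 ≤ φ b := circleAverage_nonneg_of_nonneg (fun z _ => sq_nonneg _)
    positivity
  have h1 : ∫⁻ r in Set.Ioo b d, ENNReal.ofReal (2 * π * r * φ r) ≤ ENNReal.ofReal (C * log (d / b)) := by
    rw [← lint_inv hb hbd hCn]
    apply setLIntegral_mono' measurableSet_Ioo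
    intro r hr
    apply ENNReal.ofReal_le_ofReal
    have hr0 : 0 < r := hb.trans hr.1
    have := hmono b r hρb hr.1.le
    calc 2 * π * r * φ r = 2 * π * (r^2 * φ r) * r⁻¹ := by field_simp
      _ ≤ 2 * π * (b^2 * φ b) * r⁻¹ := by gcongr
  have h2 : ENNReal.ofReal (C * log (b / ρ)) ≤ ∫⁻ r in Set.Ioo ρ b, ENNReal.ofReal (2 * π * r * φ r) := by
    rw [← lint_inv hρ hρb.le hCn]
    apply setLIntegral_mono' measurableSet_Ioo
    intro r hr
    apply ENNReal.ofReal_le_ofReal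
    have hr0 : 0 < r := hρ.trans hr.1
    have := hmono r b hr.1 hr.2.le
    calc 2 * π * (b^2 * φ b) * r⁻¹ ≤ 2 * π * (r^2 * φ r) * r⁻¹ := by gcongr
      _ = 2 * π * r * φ r := by field_simp
  have l1 : 0 ≤ log (b / ρ) := log_nonneg (by rw [le_div_iff₀ hρ]; linarith)
  have l2 : 0 ≤ log (d / b) := log_nonneg (by rw [le_div_iff₀ hb]; linarith)
  calc _ ≤ ENNReal.ofReal (log (b / ρ)) * ENNReal.ofReal (C * log (d / b)) := by gcongr
    _ = ENNReal.ofReal (log (d / b)) * ENNReal.ofReal (C * log (b / ρ)) := by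
      rw [← ENNReal.ofReal_mul l1, ← ENNReal.ofReal_mul l2]; congr 1; ring
    _ ≤ _ := by gcongr

open Real in
lemma int_bound {g : ℂ → ℝ} {b d : ℝ} (hb : 0 < b) (hbd : b < d)
    (hg : InnerProductSpace.HarmonicOnNhd g (ball 0 d)) :
    ENNReal.ofReal (d ^ 2 - b ^ 2) * ∫⁻ z in {z : ℂ | 0 < ‖z‖ ∧ ‖z‖ < b}, ENNReal.ofReal (g z ^ 2) ≤
      ENNReal.ofReal (b ^ 2) * ∫⁻ z in {z : ℂ | b < ‖z‖ ∧ ‖z‖ < d}, ENNReal.ofReal (g z ^ 2) := by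
  have hc : ContinuousOn (fun z => g z ^ 2) (ball 0 d) := hg.contDiffOn.continuousOn.pow 2
  have hm : ∀ z : ℂ, ‖z‖ < d → z ∈ ball (0:ℂ) d := by
    intro z hz; simpa using hz
  rw [lintegral_annulus le_rfl (fun z => sq_nonneg _) (hc.mono fun z hz => hm z (hz.2.trans hbd)),
    lintegral_annulus hb.le (fun z => sq_nonneg _) (hc.mono fun z hz => hm z hz.2)]
  set φ : ℝ → ℝ := fun r => circleAverage (fun z => g z ^ 2) 0 r with hφ
  have hmono : ∀ r s, 0 ≤ r → r ≤ s → s < d → φ r ≤ φ s := fun r s hr hrs hsd =>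
    int_mean_mono hg hr hrs hsd
  set C := 2 * π * φ b with hC
  have hCn : 0 ≤ C := by
    have : 0 ≤ φ b := circleAverage_nonneg_of_nonneg (fun z _ => sq_nonneg _)
    positivity
  have h1 : ∫⁻ r in Set.Ioo 0 b, ENNReal.ofReal (2 * π * r * φ r) ≤ ENNReal.ofReal (C * ((b^2 - 0^2)/2)) := by
    rw [← lint_id le_rfl hb.le hCn]
    apply setLIntegral_mono' measurableSet_Ioo
    intro r hr
    apply ENNReal.ofReal_le_ofReal
    have hr0 : 0 < r := hr.1
    have := hmono r b hr0.le hr.2.le hbd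
    calc 2 * π * r * φ r ≤ 2 * π * r * φ b := by gcongr
      _ = _ := by rw [hC]; ring
  have h2 : ENNReal.ofReal (C * ((d^2 - b^2)/2)) ≤ ∫⁻ r in Set.Ioo b d, ENNReal.ofReal (2 * π * r * φ r) := by
    rw [← lint_id hb.le hbd.le hCn]
    apply setLIntegral_mono' measurableSet_Ioo
    intro r hr
    apply ENNReal.ofReal_le_ofReal
    have hr0 : 0 < r := hb.trans hr.1
    have := hmono b r hb.le hr.1.le hr.2
    calc C * r = 2 * π * r * φ b := by rw [hC]; ring
      _ ≤ _ := by gcongr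
  have l1 : 0 ≤ d^2 - b^2 := by nlinarith
  calc _ ≤ ENNReal.ofReal (d^2 - b^2) * ENNReal.ofReal (C * ((b^2 - 0^2)/2)) := by gcongr
    _ = ENNReal.ofReal (b^2) * ENNReal.ofReal (C * ((d^2 - b^2)/2)) := by
      rw [← ENNReal.ofReal_mul l1, ← ENNReal.ofReal_mul (by positivity)]; congr 1; ring
    _ ≤ _ := by gcongr

def TT (c : Pt) (z : ℂ) : Pt := Complex.orthonormalBasisOneI.repr z + c

lemma TT_mp (c : Pt) : MeasurePreserving (TT c) :=
  (measurePreserving_add_right volume c).comp (LinearIsometryEquiv.measurePreserving _)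

lemma TT_emb (c : Pt) : MeasurableEmbedding (TT c) :=
  ((Complex.orthonormalBasisOneI.repr.toHomeomorph.trans (Homeomorph.addRight c))).measurableEmbedding

lemma TT_dist (c : Pt) (z : ℂ) : dist (TT c z) c = ‖z‖ := by
  simp [TT, dist_eq_norm]

lemma TT_lint (c : Pt) (a b : ℝ) (F : Pt → ENNReal) :
    ∫⁻ x in {x | a < dist x c ∧ dist x c < b}, F x = ∫⁻ z in {z : ℂ | a < ‖z‖ ∧ ‖z‖ < b}, F (TT c z) := by
  rw [← (TT_mp c).setLIntegral_comp_preimage_emb (TT_emb c)]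
  congr 2
  ext z
  simp [TT_dist]

open Laplacian in
lemma harm_transfer {f : Pt → ℝ} {U : Set Pt} (hU : IsOpen U) (hf : IsHarmonicOn f U) (c : Pt) :
    InnerProductSpace.HarmonicOnNhd (fun z => f (TT c z)) (TT c ⁻¹' U) := by
  have hTc : ContDiff ℝ 2 (TT c) := by
    have : ContDiff ℝ 2 Complex.orthonormalBasisOneI.repr :=
      Complex.orthonormalBasisOneI.repr.toContinuousLinearEquiv.contDiff
    exact this.add contDiff_const
  have hUo : IsOpen (TT c ⁻¹' U) := hU.preimage hTc.continuous
  have hCD : ∀ z ∈ TT c ⁻¹' U, ContDiffAt ℝ 2 f (TT c z) := fun z hz =>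
    hf.1.contDiffAt (hU.mem_nhds hz)
  have hlap : ∀ z ∈ TT c ⁻¹' U, Laplacian.laplacian (fun z => f (TT c z)) z = 0 := by
    intro z hz
    rw [InnerProductSpace.laplacian_eq_iteratedFDeriv_orthonormalBasis _ Complex.orthonormalBasisOneI]
    rw [← hf.2 _ hz, lap]
    apply Finset.sum_congr rfl
    intro i _
    set L : ℂ ≃L[ℝ] Pt := Complex.orthonormalBasisOneI.repr.toContinuousLinearEquiv with hL
    have e : (fun z => f (TT c z)) = (fun y => f (y + c)) ∘ L := rfl
    have e2 := L.iteratedFDerivWithin_comp_right (fun y => f (y + c)) uniqueDiffOn_univ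
      (Set.mem_univ (L z)) 2
    rw [Set.preimage_univ, iteratedFDerivWithin_univ, iteratedFDerivWithin_univ] at e2
    rw [e, e2, iteratedFDeriv_comp_add_right]
    rw [ContinuousMultilinearMap.compContinuousLinearMap_apply]
    have e3 : (fun k : Fin 2 => (L : ℂ →L[ℝ] Pt)
        ((![Complex.orthonormalBasisOneI i, Complex.orthonormalBasisOneI i] : Fin 2 → ℂ) k)) =
        fun _ => EuclideanSpace.single i (1 : ℝ) := by
      have e4 : (L : ℂ →L[ℝ] Pt) (Complex.orthonormalBasisOneI i) = EuclideanSpace.single i (1 : ℝ) :=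
        Complex.orthonormalBasisOneI.repr_self i
      funext k
      fin_cases k
      · exact e4
      · exact e4
    exact congrArg _ e3
  intro z hz
  refine ⟨(hCD z hz).comp z hTc.contDiffAt, ?_⟩
  filter_upwards [hUo.mem_nhds hz] with w hw
  exact hlap w hw

lemma ext_bound_Pt {h : Pt → ℝ} {c : Pt} {ρ b d : ℝ} (hρ : 0 < ρ) (hρb : ρ < b) (hbd : b ≤ d)
    (hh : IsHarmonicOn h (closedBall c ρ)ᶜ)
    (hlim : Tendsto h (cocompact Pt) (nhds 0)) :
    ENNReal.ofReal (Real.log (b / ρ)) * ∫⁻ x in {x | b < dist x c ∧ dist x c < d}, ENNReal.ofReal (h x ^ 2) ≤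
      ENNReal.ofReal (Real.log (d / b)) * ∫⁻ x in {x | ρ < dist x c ∧ dist x c < b}, ENNReal.ofReal (h x ^ 2) := by
  rw [TT_lint, TT_lint]
  apply ext_bound (h := fun z => h (TT c z)) hρ hρb hbd
  · have := harm_transfer isClosed_closedBall.isOpen_compl hh c
    convert this using 1
    ext z
    simp [TT_dist]
  · apply hlim.comp
    exact (Complex.orthonormalBasisOneI.repr.toHomeomorph.trans (Homeomorph.addRight c)).isClosedEmbedding.tendsto_cocompact

lemma int_bound_Pt {g : Pt → ℝ} {c : Pt} {b d : ℝ} (hb : 0 < b) (hbd : b < d)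
    (hg : IsHarmonicOn g (ball c d)) :
    ENNReal.ofReal (d ^ 2 - b ^ 2) * ∫⁻ x in {x | 0 < dist x c ∧ dist x c < b}, ENNReal.ofReal (g x ^ 2) ≤
      ENNReal.ofReal (b ^ 2) * ∫⁻ x in {x | b < dist x c ∧ dist x c < d}, ENNReal.ofReal (g x ^ 2) := by
  rw [TT_lint, TT_lint]
  apply int_bound (g := fun z => g (TT c z)) hb hbd
  have := harm_transfer isOpen_ball hg c
  convert this using 1
  ext z
  simp [TT_dist]

lemma IsHarmonicOn.mono {f : Pt → ℝ} {U V : Set Pt} (hf : IsHarmonicOn f U) (h : V ⊆ U) :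
    IsHarmonicOn f V := ⟨hf.1.mono h, fun x hx => hf.2 x (h hx)⟩

lemma cs_sq {μ : Measure Pt} {f g : Pt → ℝ} (hf : MemLp f 2 μ) (hg : MemLp g 2 μ) :
    (∫ x, f x * g x ∂μ) ^ 2 ≤ (∫ x, f x ^ 2 ∂μ) * ∫ x, g x ^ 2 ∂μ := by
  have key : ∀ {f g : Pt → ℝ} (hf : MemLp f 2 μ) (hg : MemLp g 2 μ),
      inner ℝ (hf.toLp f) (hg.toLp g) = ∫ x, f x * g x ∂μ := by
    intro f g hf hg
    rw [L2.inner_def]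
    apply integral_congr_ae
    filter_upwards [hf.coeFn_toLp, hg.coeFn_toLp] with x h1 h2
    rw [h1, h2]; simp [mul_comm]
  have h1 := abs_real_inner_le_norm (hf.toLp f) (hg.toLp g)
  have h2 : (inner ℝ (hf.toLp f) (hg.toLp g)) ^ 2 ≤ ‖hf.toLp f‖ ^ 2 * ‖hg.toLp g‖ ^ 2 := by
    rw [← sq_abs, ← mul_pow]; gcongr
  rw [← real_inner_self_eq_norm_sq, ← real_inner_self_eq_norm_sq, key, key, key] at h2
  simpa [pow_two] using h2

/-- conversion of an `ENNReal` comparison into real integrals -/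
lemma to_real_bound {u : Pt → ℝ} {F A P Q : Set Pt} {a b : ℝ} (ha : 0 ≤ a) (hb : 0 ≤ b)
    (hi : IntegrableOn (fun x => u x ^ 2) F) (hAF : A ⊆ F) (hQF : Q ⊆ F)
    (hAP : A ≤ᵐ[volume] P)
    (hle : ENNReal.ofReal a * ∫⁻ x in P, ENNReal.ofReal (u x ^ 2) ≤
      ENNReal.ofReal b * ∫⁻ x in Q, ENNReal.ofReal (u x ^ 2)) :
    a * ∫ x in A, u x ^ 2 ≤ b * ∫ x in F, u x ^ 2 := by
  have n : ∀ μ : Measure Pt, 0 ≤ᵐ[μ] fun x => u x ^ 2 := fun μ => Eventually.of_forall fun x => sq_nonneg _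
  have hF : 0 ≤ ∫ x in F, u x ^ 2 := integral_nonneg fun x => sq_nonneg _
  rw [← ENNReal.ofReal_le_ofReal_iff (by positivity), ENNReal.ofReal_mul ha, ENNReal.ofReal_mul hb,
    ofReal_integral_eq_lintegral_ofReal (hi.mono_set hAF) (n _), ofReal_integral_eq_lintegral_ofReal hi (n _)]
  calc _ ≤ _ := by gcongr 1; exact lintegral_mono_set' hAP
    _ ≤ _ := hle
    _ ≤ _ := by gcongr 1; exact lintegral_mono_set hQF

lemma geom_num {Re Ri Rp Rm δ δ₀ : ℝ} (h0 : 0 < Rm) (h1 : Rm < Rp) (h2 : Rp < Ri) (h3 : Ri < Re)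
    (hm : Rm = Re * Real.exp (-δ ^ 2)) (hp : Rp = Re * Real.exp (-δ))
    (hd : δ₀ = 2 + Real.log (Re / Ri)) (hδ : 4 * δ₀ < δ) :
    2 < δ₀ ∧ Real.log (Rp / Rm) = δ ^ 2 - δ ∧ Real.log (Re / Rp) = δ ∧ (δ + 1) * Rp ^ 2 ≤ Ri ^ 2 := by
  have hRp : 0 < Rp := h0.trans h1
  have hRi : 0 < Ri := hRp.trans h2
  have hRe : 0 < Re := hRi.trans h3
  have l1 : 0 < Real.log (Re / Ri) := Real.log_pos (by rw [lt_div_iff₀ hRi]; linarith)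
  have lm : Real.log Rm = Real.log Re + (-δ^2) := by rw [hm, Real.log_mul hRe.ne' (Real.exp_pos _).ne', Real.log_exp]
  have lp : Real.log Rp = Real.log Re + (-δ) := by rw [hp, Real.log_mul hRe.ne' (Real.exp_pos _).ne', Real.log_exp]
  refine ⟨by linarith, ?_, ?_, ?_⟩
  · rw [Real.log_div hRp.ne' h0.ne', lm, lp]; ring
  · rw [Real.log_div hRe.ne' hRp.ne', lp]; ring
  · have l2 : Real.log (Ri / Rp) = δ - (δ₀ - 2) := by
      rw [Real.log_div hRi.ne' hRp.ne', lp, hd, Real.log_div hRe.ne' hRi.ne']; ring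
    have e : Ri / Rp = Real.exp (δ - (δ₀ - 2)) := by rw [← l2, Real.exp_log (by positivity)]
    have e2 : (Ri / Rp) ^ 2 = Real.exp (2 * (δ - (δ₀ - 2))) := by
      rw [e, ← Real.exp_nat_mul]; norm_num
    have := Real.add_one_le_exp (2 * (δ - (δ₀ - 2)))
    rw [← e2, div_pow, le_div_iff₀ (by positivity)] at this
    refine le_trans ?_ this
    gcongr
    linarith

lemma inner_bound {𝒢 𝒪 : Set Pt} {c : Pt} {Re Ri Rp Rm δ δ₀ : ℝ}
    (geom : Geometry 𝒢 𝒪 c Re Ri Rp Rm δ δ₀) (hδ : 4 * δ₀ < δ)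
    {h g : Pt → ℝ} (hh : IsHarmonicOn h (closure 𝒪)ᶜ)
    (hlim : Tendsto h (cocompact Pt) (nhds 0)) (hg : IsHarmonicOn g 𝒢)
    (hhm : MemLp h 2 (volume.restrict (𝒢 \ closure 𝒪)))
    (hgm : MemLp g 2 (volume.restrict (𝒢 \ closure 𝒪))) :
    (∫ x in 𝒢 \ closure 𝒪, h x * g x) ^ 2 ≤
      (4 * δ₀ / δ) * ((∫ x in 𝒢 \ closure 𝒪, h x ^ 2) * ∫ x in 𝒢 \ closure 𝒪, g x ^ 2) := by
  obtain ⟨hd2, hl1, hl2, hnum⟩ := geom_num geom.Rm_pos geom.Rm_lt_Rp geom.Rp_lt_Ri geom.Ri_lt_Re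
    geom.Rm_eq geom.Rp_eq geom.δ₀_eq hδ
  have hRp : 0 < Rp := geom.Rm_pos.trans geom.Rm_lt_Rp
  set F := 𝒢 \ closure 𝒪 with hF
  have hih : IntegrableOn (fun x => h x ^ 2) F := hhm.integrable_sq
  have hig : IntegrableOn (fun x => g x ^ 2) F := hgm.integrable_sq
  have hOm : closure 𝒪 ⊆ closedBall c Rm := geom.clO_sub.trans ball_subset_closedBall
  have b1 := ext_bound_Pt geom.Rm_pos geom.Rm_lt_Rp (geom.Rp_lt_Ri.trans geom.Ri_lt_Re).le
    (hh.mono (Set.compl_subset_compl.2 hOm)) hlim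
  have b2 := int_bound_Pt hRp geom.Rp_lt_Ri (hg.mono (ball_subset_closedBall.trans geom.clDi_sub))
  rw [hl1, hl2] at b1
  have hsph : ∀ᵐ x : Pt ∂volume, x ∉ sphere c Rp :=
    measure_eq_zero_iff_ae_notMem.1 (Measure.addHaar_sphere volume c Rp)
  have hpt : ∀ᵐ x : Pt ∂volume, x ∉ ({c} : Set Pt) :=
    measure_eq_zero_iff_ae_notMem.1 (measure_singleton c)
  have c1 : (δ ^ 2 - δ) * ∫ x in F \ ball c Rp, h x ^ 2 ≤ δ * ∫ x in F, h x ^ 2 := by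
    refine to_real_bound (by nlinarith) (by linarith) hih Set.sdiff_subset ?_ ?_ b1
    · rintro x ⟨h1, h2⟩
      refine ⟨geom.clDi_sub ?_, fun h3 => ?_⟩
      · rw [mem_closedBall]; linarith [geom.Rp_lt_Ri]
      · have := hOm h3; rw [mem_closedBall] at this; linarith
    · filter_upwards [hsph] with x hx hxA
      have h1 : ¬ dist x c < Rp := hxA.2
      refine ⟨lt_of_le_of_ne (not_lt.1 h1) (fun h => hx h.symm), ?_⟩
      exact geom.clG_sub (subset_closure hxA.1.1)
  have c2 : (Ri ^ 2 - Rp ^ 2) * ∫ x in F ∩ ball c Rp, g x ^ 2 ≤ Rp ^ 2 * ∫ x in F, g x ^ 2 := by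
    refine to_real_bound (by nlinarith [geom.Rp_lt_Ri]) (by positivity) hig Set.inter_subset_left ?_ ?_ b2
    · rintro x ⟨h1, h2⟩
      refine ⟨geom.clDi_sub ?_, fun h3 => ?_⟩
      · rw [mem_closedBall]; linarith
      · have := hOm h3; rw [mem_closedBall] at this; linarith [geom.Rm_lt_Rp]
    · filter_upwards [hpt] with x hx hxA
      exact ⟨dist_pos.2 hx, hxA.2⟩
  have hihg : IntegrableOn (fun x => h x * g x) F := hhm.integrable_mul hgm
  have split := integral_inter_add_sdiff (measurableSet_ball (x := c) (ε := Rp)) hihg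
  have m1 : ∀ {u : Pt → ℝ} {A : Set Pt}, MemLp u 2 (volume.restrict F) → A ⊆ F → MemLp u 2 (volume.restrict A) :=
    fun hu hA => hu.mono_measure (Measure.restrict_mono hA le_rfl)
  have s1 := cs_sq (m1 hhm Set.inter_subset_left) (m1 hgm (Set.inter_subset_left (s := F) (t := ball c Rp)))
  have s2 := cs_sq (m1 hhm Set.sdiff_subset) (m1 hgm (Set.sdiff_subset (s := F) (t := ball c Rp)))
  have mono : ∀ {u : Pt → ℝ} {A : Set Pt}, IntegrableOn (fun x => u x ^ 2) F → A ⊆ F →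
      ∫ x in A, u x ^ 2 ≤ ∫ x in F, u x ^ 2 := fun hu hA =>
    setIntegral_mono_set hu (Eventually.of_forall fun x => sq_nonneg _) (Eventually.of_forall hA)
  have t1 := mono hih (Set.inter_subset_left (s := F) (t := ball c Rp))
  have t2 := mono hig (Set.sdiff_subset (s := F) (t := ball c Rp))
  have nn : ∀ (u : Pt → ℝ) (A : Set Pt), 0 ≤ ∫ x in A, u x ^ 2 := fun u A => integral_nonneg fun x => sq_nonneg _
  rw [← split]
  have n1 := nn h F
  have n2 := nn g F
  have n3 := nn h (F \ ball c Rp)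
  have n4 := nn g (F ∩ ball c Rp)
  have n5 := nn h (F ∩ ball c Rp)
  have n6 := nn g (F \ ball c Rp)
  generalize (∫ x in F ∩ ball c Rp, h x * g x) = X at *
  generalize (∫ x in F \ ball c Rp, h x * g x) = Y at *
  generalize (∫ x in F, h x ^ 2) = H at *
  generalize (∫ x in F, g x ^ 2) = G at *
  generalize (∫ x in F \ ball c Rp, h x ^ 2) = H2 at *
  generalize (∫ x in F ∩ ball c Rp, g x ^ 2) = G1 at *
  generalize (∫ x in F ∩ ball c Rp, h x ^ 2) = H1 at *
  generalize (∫ x in F \ ball c Rp, g x ^ 2) = G2 at *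
  have hδ8 : 8 < δ := by linarith
  have d1 : (δ - 1) * H2 ≤ H := by
    have : δ * ((δ - 1) * H2) ≤ δ * H := by nlinarith
    exact le_of_mul_le_mul_left this (by linarith)
  have d2 : δ * G1 ≤ G := by
    have : Rp ^ 2 * (δ * G1) ≤ Rp ^ 2 * G := by
      refine le_trans ?_ c2
      nlinarith
    exact le_of_mul_le_mul_left this (by positivity)
  have e1 : δ * X ^ 2 ≤ H * G := by
    calc δ * X ^ 2 ≤ δ * (H1 * G1) := by gcongr
      _ = H1 * (δ * G1) := by ring
      _ ≤ H * G := by gcongr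
  have e2 : (δ - 1) * Y ^ 2 ≤ H * G := by
    calc (δ - 1) * Y ^ 2 ≤ (δ - 1) * (H2 * G2) := by gcongr; linarith
      _ = ((δ - 1) * H2) * G2 := by ring
      _ ≤ H * G := by gcongr
  have e3 : δ * Y ^ 2 ≤ 2 * (H * G) := by nlinarith [sq_nonneg Y]
  have e4 : (X + Y) ^ 2 ≤ 2 * X ^ 2 + 2 * Y ^ 2 := by nlinarith [sq_nonneg (X - Y)]
  rw [div_mul_eq_mul_div, le_div_iff₀ (by linarith)]
  have hHG : 0 ≤ H * G := by positivity
  calc (X + Y) ^ 2 * δ ≤ (2 * X ^ 2 + 2 * Y ^ 2) * δ := by gcongr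
    _ ≤ 6 * (H * G) := by linarith
    _ ≤ 4 * δ₀ * (H * G) := by gcongr; linarith

lemma IsHarmonicOn.add_smul {f g : Pt → ℝ} {U : Set Pt} (hU : IsOpen U) (hf : IsHarmonicOn f U)
    (hg : IsHarmonicOn g U) (a : ℝ) : IsHarmonicOn (fun x => a * f x + g x) U := by
  refine ⟨(contDiffOn_const.mul hf.1).add hg.1, fun x hx => ?_⟩
  have h1 := hf.1.contDiffAt (hU.mem_nhds hx)
  have h2 := hg.1.contDiffAt (hU.mem_nhds hx)
  have h3 : iteratedFDeriv ℝ 2 (fun x => a * f x + g x) x = a • iteratedFDeriv ℝ 2 f x + iteratedFDeriv ℝ 2 g x := by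
    have : (fun x => a * f x + g x) = a • f + g := rfl
    have h1a : ContDiffAt ℝ 2 (a • f) x := h1.const_smul a
    rw [this, iteratedFDeriv_add_apply h1a h2, iteratedFDeriv_const_smul_apply h1]
  have e1 := hf.2 x hx
  have e2 := hg.2 x hx
  simp only [lap, Fin.sum_univ_two] at *
  rw [h3]
  simp only [add_apply, smul_apply, smul_eq_mul]
  linear_combination a * e1 + e2

lemma HG_span {𝒢 F : Set Pt} (hG : IsOpen 𝒢) {f : Lp ℝ 2 (volume.restrict F)}
    (hf : f ∈ Submodule.span ℝ {f : Lp ℝ 2 (volume.restrict F) |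
      ∃ g : Pt → ℝ, IsHarmonicOn g 𝒢 ∧ IntegrableOn (fun x => g x ^ 2) 𝒢 ∧
        (f : Pt → ℝ) =ᵐ[volume.restrict F] g}) :
    ∃ g : Pt → ℝ, IsHarmonicOn g 𝒢 ∧ (f : Pt → ℝ) =ᵐ[volume.restrict F] g := by
  have hz : IsHarmonicOn (fun _ => 0) 𝒢 := by
    refine ⟨contDiffOn_const, fun x _ => ?_⟩
    simp [lap]
  induction hf using Submodule.span_induction with
  | mem f hf => obtain ⟨g, h1, -, h2⟩ := hf; exact ⟨g, h1, h2⟩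
  | zero => exact ⟨_, hz, Lp.coeFn_zero _ _ _⟩
  | add f₁ f₂ _ _ ih1 ih2 =>
    obtain ⟨g1, a1, b1⟩ := ih1
    obtain ⟨g2, a2, b2⟩ := ih2
    refine ⟨_, a1.add_smul hG a2 1, ?_⟩
    filter_upwards [Lp.coeFn_add f₁ f₂, b1, b2] with x e1 e2 e3
    rw [e1, Pi.add_apply, e2, e3]; ring
  | smul a f _ ih =>
    obtain ⟨g, a1, b1⟩ := ih
    refine ⟨_, a1.add_smul hG hz a, ?_⟩
    filter_upwards [Lp.coeFn_smul a f, b1] with x e1 e2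
    rw [e1, Pi.smul_apply, e2, smul_eq_mul]; ring

lemma proj_est {E : Type*} [NormedAddCommGroup E] [InnerProductSpace ℝ E] (K : Submodule ℝ E)
    [K.HasOrthogonalProjection] (v : E) {δ δ₀ : ℝ} (hd0 : 0 < δ₀) (hδ : 4 * δ₀ < δ)
    (hspan : ∀ f ∈ K, (inner ℝ v f) ^ 2 ≤ (4 * δ₀ / δ) * (‖v‖ ^ 2 * ‖f‖ ^ 2)) :
    ‖v‖ ≤ Real.sqrt (δ / (δ - 4 * δ₀)) * ‖v - (K.orthogonalProjectionOnto v : E)‖ := by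
  set p : K := K.orthogonalProjectionOnto v with hp
  set κ := 4 * δ₀ / δ with hκ
  have hd : 0 < δ - 4 * δ₀ := by linarith
  have hδp : 0 < δ := by linarith
  have hκ0 : 0 ≤ κ := by positivity
  have hin : inner ℝ v (p : E) = ‖(p : E)‖ ^ 2 := by
    have h1 := Submodule.inner_orthogonalProjectionOnto_eq_of_mem_right p v
    rw [← hp, real_inner_self_eq_norm_sq] at h1
    rw [← h1]
    rfl
  have hpy : ‖v‖ ^ 2 = ‖(p : E)‖ ^ 2 + ‖v - (p : E)‖ ^ 2 := by
    rw [norm_sub_sq_real, hin]; ring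
  have hb := hspan p p.2
  rw [hin] at hb
  generalize ‖(p : E)‖ = P at *
  have hPv : P ^ 2 ≤ κ * ‖v‖ ^ 2 := by
    by_cases hP : P ^ 2 = 0
    · rw [hP]; positivity
    · have hP : 0 < P ^ 2 := lt_of_le_of_ne (sq_nonneg P) (Ne.symm hP)
      have : P ^ 2 * P ^ 2 ≤ P ^ 2 * (κ * ‖v‖ ^ 2) := by nlinarith
      exact le_of_mul_le_mul_left this hP
  refine le_of_sq_le_sq ?_ (by positivity)
  rw [mul_pow, Real.sq_sqrt (by positivity), div_mul_eq_mul_div, le_div_iff₀ hd]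
  have h1 : δ * P ^ 2 ≤ 4 * δ₀ * ‖v‖ ^ 2 := by
    calc δ * P ^ 2 ≤ δ * (κ * ‖v‖ ^ 2) := by gcongr
      _ = 4 * δ₀ * ‖v‖ ^ 2 := by rw [hκ]; field_simp
  nlinarith

theorem stmt14 (𝒢 𝒪 : Set Pt) (c : Pt) (Re Ri Rp Rm δ δ₀ : ℝ)
    (geom : Geometry 𝒢 𝒪 c Re Ri Rp Rm δ δ₀) (hδ : 4 * δ₀ < δ)
    (h : Pt → ℝ) (hh : IsHarmonicOn h (closure 𝒪)ᶜ)
    (hloc : LocallyIntegrableOn (fun x => h x ^ 2) (closure 𝒪)ᶜ)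
    (hlim : Tendsto h (cocompact Pt) (nhds 0))
    (hmem : MemLp h 2 (volume.restrict (𝒢 \ closure 𝒪))) :
    ‖hmem.toLp h‖
      ≤ Real.sqrt (δ / (δ - 4 * δ₀))
          * ‖hmem.toLp h
              - (Submodule.orthogonalProjectionOnto (HGclosure 𝒢 (𝒢 \ closure 𝒪)) (hmem.toLp h) :
                  Lp ℝ 2 (volume.restrict (𝒢 \ closure 𝒪)))‖ := by
  obtain ⟨hd2, -, -, -⟩ := geom_num geom.Rm_pos geom.Rm_lt_Rp geom.Rp_lt_Ri geom.Ri_lt_Re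
    geom.Rm_eq geom.Rp_eq geom.δ₀_eq hδ
  set F := 𝒢 \ closure 𝒪 with hF
  set v := hmem.toLp h with hv
  set κ := 4 * δ₀ / δ with hκ
  have hκ0 : 0 ≤ κ := by apply div_nonneg <;> linarith
  have hspan : ∀ f : Lp ℝ 2 (volume.restrict F), f ∈ HGclosure 𝒢 F →
      (inner ℝ v f) ^ 2 ≤ κ * (‖v‖ ^ 2 * ‖f‖ ^ 2) := by
    intro f hf
    have hcl : IsClosed {f : Lp ℝ 2 (volume.restrict F) | (inner ℝ v f) ^ 2 ≤ κ * (‖v‖ ^ 2 * ‖f‖ ^ 2)} := by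
      apply isClosed_le <;> fun_prop
    refine closure_minimal ?_ hcl hf
    intro f hf
    obtain ⟨g, hg, hfg⟩ := HG_span geom.openG hf
    have hgm : MemLp g 2 (volume.restrict F) := (memLp_congr_ae hfg).1 (Lp.memLp f)
    have hfe : f = hgm.toLp g := by
      apply Lp.ext
      exact hfg.trans hgm.coeFn_toLp.symm
    have key := inner_bound geom hδ hh hlim hg hmem hgm
    have inn : ∀ {f g : Pt → ℝ} (hf : MemLp f 2 (volume.restrict F)) (hg : MemLp g 2 (volume.restrict F)),
        inner ℝ (hf.toLp f) (hg.toLp g) = ∫ x in F, f x * g x := by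
      intro f g hf hg
      rw [L2.inner_def]
      apply integral_congr_ae
      filter_upwards [hf.coeFn_toLp, hg.coeFn_toLp] with x h1 h2
      rw [h1, h2]; simp [mul_comm]
    show (inner ℝ v f) ^ 2 ≤ κ * (‖v‖ ^ 2 * ‖f‖ ^ 2)
    rw [← real_inner_self_eq_norm_sq, ← real_inner_self_eq_norm_sq, hfe, hv, inn, inn, inn]
    simpa [pow_two] using key
  exact proj_est (HGclosure 𝒢 F) v (by linarith) hδ (fun f hf => hspan f hf)
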